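/- arXiv:2310.05169 — 2 statements merged into one kernel-verified Lean document; each statement's English description precedes it below -/
import Mathlib

section
/- L²-risk bound for the 1D blow-up setup (Theorem 2): let u(x,t) = x/(t-1) be the solution of u_t + u u_x = 0 on (-1,1)×(-1+δ, δ) for δ ∈ (0,1), and u* any C¹ surrogate with residuals R_int = ∂_t u* + ∂_x((u*)²/2), R_tb(x) = u*(x,-1+δ) - x/(-2+δ), R_{sb,±1}(t) = u*(±1,t) ∓ 1/(t-1) (so R_{sb,-1}(t)=u*(-1,t)-1/(1-t), R_{sb,1}(t)=u*(1,t)-1/(t-1)). Then with C = 1 + 2/(1-δ), C_{1b} = 1/(1-δ)², C_{2b} = ‖u*(1,·)‖_∞ + (3/2)/(1-δ): ∫∫ |u-u*|² dx dt ≤ (1 + C e^C)[∫_{-1}^1 R_tb(x)² dx + 2C_{2b}(∫R_{sb,-1}² + ∫R_{sb,1}²) + 2C_{1b}((∫R_{sb,-1}²)^{1/2} + (∫R_{sb,1}²)^{1/2}) + ∫∫ R_int²]. -/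
open MeasureTheory Set

lemma hasDerivAt_max_zero_pow (n : ℕ) (x : ℝ) :
    HasDerivAt (fun y : ℝ => max y 0 ^ (n + 2)) ((n + 2) * max x 0 ^ (n + 1)) x := by
  have key : ∀ y : ℝ, y ≠ 0 →
      HasDerivAt (fun y : ℝ => max y 0 ^ (n + 2)) ((n + 2) * max y 0 ^ (n + 1)) y := by
    intro y hy
    rcases lt_or_gt_of_ne hy with h | h
    · have h0 : HasDerivAt (fun _ : ℝ => (0 : ℝ)) 0 y := hasDerivAt_const y 0
      have := h0.congr_of_eventuallyEq (f₁ := fun y : ℝ => max y 0 ^ (n + 2)) (by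
        filter_upwards [Iio_mem_nhds h] with z hz
        simp [max_eq_right (le_of_lt (mem_Iio.1 hz))])
      simpa [max_eq_right h.le] using this
    · have h0 := hasDerivAt_pow (n + 2) y
      have := h0.congr_of_eventuallyEq (f₁ := fun y : ℝ => max y 0 ^ (n + 2)) (by
        filter_upwards [Ioi_mem_nhds h] with z hz
        simp [max_eq_left (le_of_lt (mem_Ioi.1 hz))])
      rw [max_eq_left h.le]
      exact this.congr_deriv (by push_cast; simp)
  rcases eq_or_ne x 0 with rfl | hx
  · exact hasDerivAt_of_hasDerivAt_of_ne key (by fun_prop) (by fun_prop)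
  · exact key x hx

/-- The quadratic energy `e ^ 2 / 2`, continued linearly above the level `k`. -/
noncomputable def truncEnergy (k e : ℝ) : ℝ := (e ^ 2 - max (e - k) 0 ^ 2) / 2

/-- The derivative of `truncEnergy`. -/
noncomputable def truncSlope (k e : ℝ) : ℝ := e - max (e - k) 0

/-- The Burgers entropy flux belonging to `truncEnergy`. -/
noncomputable def truncFlux (k e : ℝ) : ℝ :=
  e ^ 3 / 3 - max (e - k) 0 ^ 3 / 3 - k * max (e - k) 0 ^ 2 / 2

/-- The part of `truncEnergy` carried by positive arguments. -/
noncomputable def posEnergy (k e : ℝ) : ℝ := (max e 0 ^ 2 - max (e - k) 0 ^ 2) / 2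

/-- The derivative of `posEnergy`. -/
noncomputable def posSlope (k e : ℝ) : ℝ := max e 0 - max (e - k) 0

/-- The Burgers entropy flux belonging to `posEnergy`. -/
noncomputable def posFlux (k e : ℝ) : ℝ :=
  max e 0 ^ 3 / 3 - max (e - k) 0 ^ 3 / 3 - k * max (e - k) 0 ^ 2 / 2

lemma hasDerivAt_max_sub_sq (k e : ℝ) :
    HasDerivAt (fun y : ℝ => max (y - k) 0 ^ 2) (2 * max (e - k) 0) e := by
  simpa using (hasDerivAt_max_zero_pow 0 (e - k)).comp_sub_const e k

lemma hasDerivAt_max_sub_cube (k e : ℝ) :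
    HasDerivAt (fun y : ℝ => max (y - k) 0 ^ 3) (3 * max (e - k) 0 ^ 2) e := by
  have := (hasDerivAt_max_zero_pow 1 (e - k)).comp_sub_const e k
  norm_num at this
  exact this

lemma hasDerivAt_truncEnergy (k e : ℝ) :
    HasDerivAt (truncEnergy k) (truncSlope k e) e := by
  refine HasDerivAt.congr_deriv (f := truncEnergy k)
    (((hasDerivAt_pow 2 e).sub (hasDerivAt_max_sub_sq k e)).div_const 2) ?_
  simp only [truncSlope]; push_cast; ring

lemma hasDerivAt_posEnergy (k e : ℝ) :
    HasDerivAt (posEnergy k) (posSlope k e) e := by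
  have h := hasDerivAt_max_sub_sq 0 e
  simp only [sub_zero] at h
  refine HasDerivAt.congr_deriv (f := posEnergy k)
    ((h.sub (hasDerivAt_max_sub_sq k e)).div_const 2) ?_
  simp only [posSlope]; ring

lemma max_sub_mul_self (k e : ℝ) :
    max (e - k) 0 * (e - k) = max (e - k) 0 ^ 2 := by
  rcases le_total (e - k) 0 with h | h
  · simp [max_eq_right h]
  · rw [max_eq_left h]; ring

lemma hasDerivAt_truncFlux (k e : ℝ) :
    HasDerivAt (truncFlux k) (e * truncSlope k e) e := by
  refine HasDerivAt.congr_deriv (f := truncFlux k) ((((hasDerivAt_pow 3 e).div_const 3).sub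
    ((hasDerivAt_max_sub_cube k e).div_const 3)).sub
    (((hasDerivAt_max_sub_sq k e).const_mul k).div_const 2)) ?_
  have := max_sub_mul_self k e
  simp only [truncSlope]; push_cast; linear_combination this

lemma hasDerivAt_posFlux (k e : ℝ) :
    HasDerivAt (posFlux k) (e * posSlope k e) e := by
  have h := hasDerivAt_max_sub_cube 0 e
  have h' := max_sub_mul_self 0 e
  simp only [sub_zero] at h h'
  refine HasDerivAt.congr_deriv (f := posFlux k) (((h.div_const 3).sub
    ((hasDerivAt_max_sub_cube k e).div_const 3)).sub
    (((hasDerivAt_max_sub_sq k e).const_mul k).div_const 2)) ?_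
  have := max_sub_mul_self k e
  simp only [posSlope]; linear_combination this - h'

lemma posEnergy_nonneg {k : ℝ} (hk : 0 ≤ k) (e : ℝ) : 0 ≤ posEnergy k e := by
  unfold posEnergy
  rcases max_cases e 0 with h | h <;> rcases max_cases (e - k) 0 with h' | h' <;>
    rw [h.1, h'.1] <;> nlinarith

lemma posEnergy_le_truncEnergy (k e : ℝ) : posEnergy k e ≤ truncEnergy k e := by
  unfold posEnergy truncEnergy
  rcases max_cases e 0 with h | h
  · rw [h.1]
  · rw [h.1]
    nlinarith

lemma truncEnergy_le (k e : ℝ) : truncEnergy k e ≤ e ^ 2 / 2 := by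
  unfold truncEnergy
  nlinarith [sq_nonneg (max (e - k) 0)]

lemma truncSlope_sq_le {k : ℝ} (hk : 0 ≤ k) (e : ℝ) :
    truncSlope k e ^ 2 ≤ 2 * truncEnergy k e := by
  unfold truncSlope truncEnergy
  rcases max_cases (e - k) 0 with h' | h' <;> rw [h'.1] <;> nlinarith

lemma posSlope_sq_le {k : ℝ} (hk : 0 ≤ k) (e : ℝ) :
    posSlope k e ^ 2 ≤ 2 * posEnergy k e := by
  unfold posSlope posEnergy
  rcases max_cases e 0 with h | h <;> rcases max_cases (e - k) 0 with h' | h' <;>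
    rw [h.1, h'.1] <;> nlinarith

lemma mul_truncSlope_le {k : ℝ} (hk : 0 ≤ k) (e : ℝ) :
    e * truncSlope k e ≤ 2 * truncEnergy k e := by
  unfold truncSlope truncEnergy
  rcases max_cases (e - k) 0 with h' | h' <;> rw [h'.1] <;> nlinarith

lemma mul_posSlope_le {k : ℝ} (hk : 0 ≤ k) (e : ℝ) :
    e * posSlope k e ≤ 2 * posEnergy k e := by
  unfold posSlope posEnergy
  rcases max_cases e 0 with h | h <;> rcases max_cases (e - k) 0 with h' | h' <;>
    rw [h.1, h'.1] <;> nlinarith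

lemma truncFlux_le {k : ℝ} (hk : 0 ≤ k) (e : ℝ) : truncFlux k e ≤ k / 2 * e ^ 2 := by
  unfold truncFlux
  rcases max_cases (e - k) 0 with h' | h' <;> rw [h'.1]
  · nlinarith [pow_nonneg hk 3]
  · nlinarith [mul_nonneg (sq_nonneg e) (sub_nonneg.2 (sub_neg.1 h'.2).le),
      mul_nonneg hk (sq_nonneg e)]

lemma posFlux_le {k : ℝ} (hk : 0 ≤ k) (e : ℝ) : posFlux k e ≤ k / 2 * e ^ 2 := by
  rcases le_total 0 e with h | h
  · simpa [posFlux, truncFlux, max_eq_left h] using truncFlux_le hk e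
  · have : e - k ≤ 0 := by linarith
    simp only [posFlux, max_eq_right h, max_eq_right this]
    have := mul_nonneg hk (sq_nonneg e)
    linarith

lemma neg_truncFlux_le {k N e : ℝ} (hk : 0 ≤ k) (hN : 0 ≤ N) (he : -e ≤ N) :
    -truncFlux k e ≤ N / 3 * e ^ 2 := by
  unfold truncFlux
  have h0 := mul_nonneg hN (sq_nonneg e)
  rcases max_cases (e - k) 0 with h' | h' <;> rw [h'.1]
  · have he' : 0 ≤ e - k := h'.2
    nlinarith [pow_nonneg hk 3, mul_nonneg hk he', mul_nonneg (mul_nonneg hk he') he',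
      mul_nonneg (mul_nonneg hk hk) he']
  · nlinarith [mul_nonneg (sq_nonneg e) (show 0 ≤ N + e by linarith)]

lemma sq_le_truncEnergy_add_posFlux {k : ℝ} (hk : 0 < k) (e : ℝ) :
    e ^ 2 ≤ 2 * truncEnergy k e + 2 / k * posFlux k e := by
  unfold truncEnergy posFlux
  rcases max_cases (e - k) 0 with h' | h' <;> rw [h'.1]
  · rw [max_eq_left (by linarith [h'.2] : (0:ℝ) ≤ e)]
    have he : 0 ≤ e - k := h'.2
    obtain ⟨p, rfl⟩ : ∃ p, e = p + k := ⟨e - k, by ring⟩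
    have : 2 / k * ((p + k) ^ 3 / 3 - (p + k - k) ^ 3 / 3 - k * (p + k - k) ^ 2 / 2)
        = p ^ 2 + 2 * k * p + 2 / 3 * k ^ 2 := by
      field_simp; ring
    rw [this]
    nlinarith [mul_nonneg hk.le he]
  · have : 0 ≤ 2 / k * (max e 0 ^ 3 / 3) := by positivity
    simp only [zero_pow, ne_eq, OfNat.ofNat_ne_zero, not_false_eq_true, zero_div, mul_zero,
      sub_zero]
    linarith

lemma entropy_production_le {a s x e R : ℝ} (ha : 1 ≤ a) (hs : 0 ≤ s) (hsa : s ≤ a)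
    (hx : -1 ≤ x) (hx' : x ≤ 1) :
    -(1 + 2 * a) * (3 * truncEnergy (2 * a) e + (1 - x) / a * posEnergy (2 * a) e)
      + (3 * truncSlope (2 * a) e + (1 - x) / a * posSlope (2 * a) e) * (R + e * s)
      - s * (3 * truncEnergy (2 * a) e + (1 - x) / a * posEnergy (2 * a) e)
      + x * s / a * posEnergy (2 * a) e - posFlux (2 * a) e / a
      ≤ -e ^ 2 + 5 / 2 * R ^ 2 := by
  have hk : 0 < 2 * a := by linarith
  have hsq := sq_le_truncEnergy_add_posFlux hk e
  have hA2 := truncSlope_sq_le hk.le e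
  have hB2 := posSlope_sq_le hk.le e
  have heA := mul_truncSlope_le hk.le e
  have heB := mul_posSlope_le hk.le e
  have hB := posEnergy_nonneg hk.le e
  have hBA := posEnergy_le_truncEnergy (2 * a) e
  have hq : 2 / (2 * a) * posFlux (2 * a) e = posFlux (2 * a) e / a := by field_simp
  rw [hq] at hsq
  generalize truncEnergy (2 * a) e = A at *
  generalize posEnergy (2 * a) e = B at *
  generalize truncSlope (2 * a) e = A' at *
  generalize posSlope (2 * a) e = B' at *
  generalize posFlux (2 * a) e / a = Q at *
  have ha0 : 0 < a := by linarith
  obtain ⟨m, hm⟩ : ∃ m, m = (1 - x) / a := ⟨_, rfl⟩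
  have hm0 : 0 ≤ m := by rw [hm]; exact div_nonneg (by linarith) ha0.le
  have hm2 : m ≤ 2 := by rw [hm, div_le_iff₀ ha0]; linarith
  have hma : m * a + x = 1 := by rw [hm]; field_simp; ring
  have hxs : x * s / a * B = s / a * B - m * s * B := by rw [hm]; field_simp; ring
  have hsa1 : s / a * B ≤ B := by
    have : s / a ≤ 1 := (div_le_one ha0).2 hsa
    nlinarith
  rw [hxs, ← hm]
  have h1 : A' * R ≤ R ^ 2 / 2 + A := by nlinarith [sq_nonneg (A' - R)]
  have h2 : m * (B' * R) ≤ R ^ 2 + m * B := by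
    have : B' * R ≤ R ^ 2 / 2 + B := by nlinarith [sq_nonneg (B' - R)]
    nlinarith [mul_le_mul_of_nonneg_left this hm0, sq_nonneg R]
  have h3 : s * (e * A') ≤ s * (2 * A) := mul_le_mul_of_nonneg_left heA hs
  have h4 : m * s * (e * B') ≤ m * s * (2 * B) :=
    mul_le_mul_of_nonneg_left heB (mul_nonneg hm0 hs)
  have hA0 : 0 ≤ A := hB.trans hBA
  have h5 : 0 ≤ (a - s) * A := mul_nonneg (by linarith) hA0
  have h6 : 0 ≤ (a - 1) * A := mul_nonneg (by linarith) hA0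
  have h7 : 0 ≤ m * a * B := by positivity
  nlinarith

lemma continuous_slice_left {f : ℝ → ℝ → ℝ} (hf : Continuous (fun p : ℝ × ℝ => f p.1 p.2))
    (t : ℝ) : Continuous (fun x => f x t) :=
  hf.comp (continuous_id.prodMk continuous_const)

lemma continuous_slice_right {f : ℝ → ℝ → ℝ} (hf : Continuous (fun p : ℝ × ℝ => f p.1 p.2))
    (x : ℝ) : Continuous (fun t => f x t) :=
  hf.comp (continuous_const.prodMk continuous_id)

lemma continuous_integral_left {a b : ℝ} {f : ℝ → ℝ → ℝ}
    (hf : Continuous (fun p : ℝ × ℝ => f p.1 p.2)) :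
    Continuous (fun t => ∫ x in a..b, f x t) :=
  intervalIntegral.continuous_parametric_intervalIntegral_of_continuous'
    (f := fun t x => f x t) (hf.comp continuous_swap) a b

lemma integral_neg_mul_add_mul {a b α β : ℝ} {f g : ℝ → ℝ} (hf : Continuous f)
    (hg : Continuous g) :
    ∫ x in a..b, (-(α * f x) + β * g x)
      = -(α * ∫ x in a..b, f x) + β * ∫ x in a..b, g x := by
  have hneg : Continuous fun x => -(α * f x) := (hf.const_mul α).neg
  rw [intervalIntegral.integral_add (hneg.intervalIntegrable _ _)
    ((hg.const_mul β).intervalIntegrable _ _), intervalIntegral.integral_neg,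
    intervalIntegral.integral_const_mul, intervalIntegral.integral_const_mul]

/-- Integrated form of a differential inequality `∂ₜ G + ∂ₓ F ≤ D` on a rectangle. -/
lemma integral_balance_le {a b c d : ℝ} (hab : a ≤ b) (hcd : c ≤ d)
    {G G' F F' D : ℝ → ℝ → ℝ}
    (hG : Continuous (fun p : ℝ × ℝ => G p.1 p.2))
    (hG' : Continuous (fun p : ℝ × ℝ => G' p.1 p.2))
    (hF : Continuous (fun p : ℝ × ℝ => F p.1 p.2))
    (hF' : Continuous (fun p : ℝ × ℝ => F' p.1 p.2))
    (hD : Continuous (fun p : ℝ × ℝ => D p.1 p.2))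
    (hGd : ∀ x, ∀ t ∈ Ioo c d, HasDerivAt (fun s => G x s) (G' x t) t)
    (hFd : ∀ x, ∀ t ∈ Icc c d, HasDerivAt (fun y => F y t) (F' x t) x)
    (hle : ∀ x ∈ Icc a b, ∀ t ∈ Icc c d, G' x t + F' x t ≤ D x t) :
    (∫ x in a..b, G x d) - (∫ x in a..b, G x c)
      + ((∫ t in c..d, F b t) - ∫ t in c..d, F a t)
      ≤ ∫ t in c..d, ∫ x in a..b, D x t := by
  have e1 : (∫ x in a..b, G x d) - (∫ x in a..b, G x c)
      = ∫ t in c..d, ∫ x in a..b, G' x t := by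
    rw [← intervalIntegral.integral_sub ((continuous_slice_left hG d).intervalIntegrable _ _)
      ((continuous_slice_left hG c).intervalIntegrable _ _)]
    have hG_int : IntegrableOn (fun p : ℝ × ℝ => G' p.1 p.2) (Icc a b ×ˢ Icc c d) :=
      hG'.continuousOn.integrableOn_compact (isCompact_Icc.prod isCompact_Icc)
    rw [← intervalIntegral_intervalIntegral_swap (F := G') (by
      rw [uIoc_of_le hab, uIoc_of_le hcd]
      exact hG_int.mono_set (prod_mono Ioc_subset_Icc_self Ioc_subset_Icc_self))]
    refine intervalIntegral.integral_congr fun x _ => ?_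
    exact (intervalIntegral.integral_eq_sub_of_hasDerivAt_of_le hcd
      (continuous_slice_right hG x).continuousOn
      (fun t ht => hGd x t ht) ((continuous_slice_right hG' x).intervalIntegrable _ _)).symm
  have e2 : ((∫ t in c..d, F b t) - ∫ t in c..d, F a t)
      = ∫ t in c..d, ∫ x in a..b, F' x t := by
    rw [← intervalIntegral.integral_sub ((continuous_slice_right hF b).intervalIntegrable _ _)
      ((continuous_slice_right hF a).intervalIntegrable _ _)]
    refine intervalIntegral.integral_congr fun t ht => ?_
    rw [uIcc_of_le hcd] at ht
    exact (intervalIntegral.integral_eq_sub_of_hasDerivAt (fun x _ => hFd x t ht)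
      ((continuous_slice_left hF' t).intervalIntegrable _ _)).symm
  rw [e1, e2, ← intervalIntegral.integral_add
    ((continuous_integral_left hG').intervalIntegrable _ _)
    ((continuous_integral_left hF').intervalIntegrable _ _)]
  refine intervalIntegral.integral_mono_on hcd
    (((continuous_integral_left hG').add (continuous_integral_left hF')).intervalIntegrable _ _)
    ((continuous_integral_left hD).intervalIntegrable _ _)
    fun t ht => ?_
  rw [← intervalIntegral.integral_add ((continuous_slice_left hG' t).intervalIntegrable _ _)
    ((continuous_slice_left hF' t).intervalIntegrable _ _)]
  exact intervalIntegral.integral_mono_on hab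
    (((continuous_slice_left hG' t).add (continuous_slice_left hF' t)).intervalIntegrable _ _)
    ((continuous_slice_left hD t).intervalIntegrable _ _) fun x hx => hle x hx t ht


/-- L²-risk bound for the 1D blow-up setup (Theorem 2): with u(x,t) = x/(t-1)
the exact solution on (-1,1)×(-1+δ,δ), u* any C¹ surrogate with residuals
R_int, R_tb, R_{sb,±1}, and constants C = 1 + 2/(1-δ), C_{1b} = 1/(1-δ)²,
C_{2b} = ‖u*(1,·)‖_∞ + (3/2)/(1-δ), the stated generalization bound holds. -/
theorem stmt15 (δ : ℝ) (hδ : δ ∈ Set.Ioo (0:ℝ) 1)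
    (ustar ut ux : ℝ → ℝ → ℝ)
    (hut : ∀ x t, HasDerivAt (fun s => ustar x s) (ut x t) t)
    (hux : ∀ x t, HasDerivAt (fun y => ustar y t) (ux x t) x)
    (hcont : Continuous (fun p : ℝ × ℝ => ustar p.1 p.2))
    (hcont_t : Continuous (fun p : ℝ × ℝ => ut p.1 p.2))
    (hcont_x : Continuous (fun p : ℝ × ℝ => ux p.1 p.2)) :
    (∫ t in (-1+δ)..δ, ∫ x in (-1:ℝ)..1, (x/(t-1) - ustar x t)^2)
      ≤ (1 + (1 + 2/(1-δ)) * Real.exp (1 + 2/(1-δ))) *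
        ((∫ x in (-1:ℝ)..1, (ustar x (-1+δ) - x/(-2+δ))^2)
          + 2 * (sSup ((fun t => |ustar 1 t|) '' Set.Icc (-1+δ) δ) + (3/2) * (1/(1-δ)))
              * ((∫ t in (-1+δ)..δ, (ustar (-1) t - 1/(1-t))^2)
                  + (∫ t in (-1+δ)..δ, (ustar 1 t - 1/(t-1))^2))
          + 2 * (1/(1-δ)^2)
              * (Real.sqrt (∫ t in (-1+δ)..δ, (ustar (-1) t - 1/(1-t))^2)
                  + Real.sqrt (∫ t in (-1+δ)..δ, (ustar 1 t - 1/(t-1))^2))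
          + (∫ t in (-1+δ)..δ, ∫ x in (-1:ℝ)..1, (ut x t + ustar x t * ux x t)^2)) := by
  obtain ⟨hδ0, hδ1⟩ := hδ
  obtain ⟨a, ha⟩ : ∃ a, a = 1 / (1 - δ) := ⟨_, rfl⟩
  have hpos : 0 < 1 - δ := by linarith
  have ha1 : 1 ≤ a := by rw [ha, le_div_iff₀ hpos]; linarith
  have ha0 : 0 < a := by linarith
  have hcd : -1 + δ ≤ δ := by linarith
  obtain ⟨N, hN⟩ : ∃ N, N = sSup ((fun t => |ustar 1 t|) '' Icc (-1 + δ) δ) := ⟨_, rfl⟩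
  have hNub : ∀ t ∈ Icc (-1 + δ) δ, |ustar 1 t| ≤ N := by
    intro t ht
    rw [hN]
    refine le_csSup (isCompact_Icc.bddAbove_image ?_) (mem_image_of_mem _ ht)
    have : Continuous fun t => ustar 1 t :=
      hcont.comp (continuous_const.prodMk continuous_id)
    exact this.abs.continuousOn
  have hN0 : 0 ≤ N := (abs_nonneg _).trans (hNub δ ⟨hcd, le_rfl⟩)
  -- `s` agrees with `1 / (1 - t)` on the time interval and is continuous everywhere
  obtain ⟨s, hs⟩ : ∃ s : ℝ → ℝ, s = fun t => 1 / (1 - min t δ) := ⟨_, rfl⟩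
  have hmin : ∀ t, 0 < 1 - min t δ := fun t => by linarith [min_le_right t δ]
  have hsc : Continuous s := by
    rw [hs]
    exact continuous_const.div (by fun_prop) fun t => (hmin t).ne'
  have hs0 : ∀ t, 0 ≤ s t := fun t => by rw [hs]; exact (one_div_pos.2 (hmin t)).le
  have hsa : ∀ t, s t ≤ a := fun t => by
    rw [hs, ha]
    exact one_div_le_one_div_of_le hpos (by linarith [min_le_right t δ])
  have hst : ∀ t ≤ δ, s t = 1 / (1 - t) := fun t ht => by simp [hs, min_eq_left ht]
  have hsd : ∀ t < δ, HasDerivAt s (s t ^ 2) t := by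
    intro t ht
    have h1 : HasDerivAt (fun t : ℝ => (1 - t)⁻¹) (-(-1) / (1 - t) ^ 2) t :=
      ((hasDerivAt_id t).const_sub 1).inv (by simp; linarith)
    refine (h1.congr_of_eventuallyEq ?_).congr_deriv ?_
    · filter_upwards [Iio_mem_nhds ht] with r hr
      rw [hst r (mem_Iio.1 hr).le, one_div]
    · rw [hst t ht.le]; simp
  have hut' : ∀ x, ∀ t ≤ δ, x / (t - 1) = -(x * s t) := by
    intro x t ht
    have h1 : (1 - t) ≠ 0 := by linarith
    have h2 : (t - 1) ≠ 0 := by intro h; apply h1; linarith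
    rw [hst t ht]
    field_simp
    ring
  -- the error, its entropy and the entropy flux
  obtain ⟨e, he⟩ : ∃ e : ℝ → ℝ → ℝ, e = fun x t => ustar x t + x * s t := ⟨_, rfl⟩
  have hsc2 : Continuous (fun p : ℝ × ℝ => s p.2) := hsc.comp continuous_snd
  have hec : Continuous (fun p : ℝ × ℝ => e p.1 p.2) := by
    rw [he]; exact hcont.add (continuous_fst.mul hsc2)
  have het : ∀ x, ∀ t < δ, HasDerivAt (fun r => e x r) (ut x t + x * s t ^ 2) t :=
    fun x t ht => by rw [he]; exact (hut x t).add ((hsd t ht).const_mul x)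
  have hex : ∀ x t, HasDerivAt (fun y => e y t) (ux x t + s t) x := fun x t => by
    rw [he]
    exact (hux x t).add (hasDerivAt_mul_const (s t))
  have heu : ∀ x t, ustar x t = e x t - x * s t := fun x t => by rw [he]; ring
  obtain ⟨w, hw⟩ : ∃ w : ℝ → ℝ, w = fun t => Real.exp (-(1 + 2 * a) * (t - (-1 + δ))) :=
    ⟨_, rfl⟩
  have hwc : Continuous w := by rw [hw]; fun_prop
  have hwc2 : Continuous (fun p : ℝ × ℝ => w p.2) := hwc.comp continuous_snd
  have hwd : ∀ t, HasDerivAt w (-(1 + 2 * a) * w t) t := fun t => by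
    rw [hw]
    have := (((hasDerivAt_id t).sub_const (-1 + δ)).const_mul (-(1 + 2 * a))).exp
    refine this.congr_deriv ?_
    simp only [id]; ring
  have hw0 : ∀ t, 0 ≤ w t := fun t => by rw [hw]; exact (Real.exp_pos _).le
  have hw1 : ∀ t ∈ Icc (-1 + δ) δ, w t ≤ 1 := fun t ht => by
    rw [hw]
    exact Real.exp_le_one_iff.2 (by nlinarith [ht.1])
  have hwl : ∀ t ∈ Icc (-1 + δ) δ, Real.exp (-(1 + 2 * a)) ≤ w t := fun t ht => by
    rw [hw]
    exact Real.exp_le_exp.2 (by nlinarith [ht.2])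
  have hwi : w (-1 + δ) = 1 := by rw [hw]; simp
  have hk : 0 ≤ 2 * a := by linarith
  have cA : Continuous (truncEnergy (2 * a)) := by unfold truncEnergy; fun_prop
  have cB : Continuous (posEnergy (2 * a)) := by unfold posEnergy; fun_prop
  have cA' : Continuous (truncSlope (2 * a)) := by unfold truncSlope; fun_prop
  have cB' : Continuous (posSlope (2 * a)) := by unfold posSlope; fun_prop
  have cP : Continuous (truncFlux (2 * a)) := by unfold truncFlux; fun_prop
  have cQ : Continuous (posFlux (2 * a)) := by unfold posFlux; fun_prop
  have cAe := cA.comp hec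
  have cBe := cB.comp hec
  have cA'e := cA'.comp hec
  have cB'e := cB'.comp hec
  have cPe := cP.comp hec
  have cQe := cQ.comp hec
  simp only [Function.comp_def] at cAe cBe cA'e cB'e cPe cQe
  let η : ℝ → ℝ → ℝ := fun x v =>
    3 * truncEnergy (2 * a) v + (1 - x) / a * posEnergy (2 * a) v
  let M : ℝ → ℝ → ℝ := fun x v =>
    3 * truncSlope (2 * a) v + (1 - x) / a * posSlope (2 * a) v
  let q : ℝ → ℝ → ℝ := fun x v =>
    3 * truncFlux (2 * a) v + (1 - x) / a * posFlux (2 * a) v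
  let R : ℝ → ℝ → ℝ := fun x t => ut x t + ustar x t * ux x t
  have hRc : Continuous (fun p : ℝ × ℝ => R p.1 p.2) := hcont_t.add (hcont.mul hcont_x)
  let G : ℝ → ℝ → ℝ := fun x t => w t * η x (e x t)
  let G' : ℝ → ℝ → ℝ := fun x t => -(1 + 2 * a) * w t * η x (e x t)
    + w t * (M x (e x t) * (ut x t + x * s t ^ 2))
  let F : ℝ → ℝ → ℝ := fun x t => w t * (-(x * s t) * η x (e x t) + q x (e x t))
  let F' : ℝ → ℝ → ℝ := fun x t => w t * (-s t * η x (e x t)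
    + -(x * s t) * (M x (e x t) * (ux x t + s t) - 1 / a * posEnergy (2 * a) (e x t))
    + (e x t * M x (e x t) * (ux x t + s t) - 1 / a * posFlux (2 * a) (e x t)))
  let D : ℝ → ℝ → ℝ := fun x t =>
    -(Real.exp (-(1 + 2 * a)) * e x t ^ 2) + 5 / 2 * R x t ^ 2
  have hηc : Continuous (fun p : ℝ × ℝ => η p.1 (e p.1 p.2)) := by
    simp only [η]; fun_prop
  have hMc : Continuous (fun p : ℝ × ℝ => M p.1 (e p.1 p.2)) := by
    simp only [M]; fun_prop
  have hqc : Continuous (fun p : ℝ × ℝ => q p.1 (e p.1 p.2)) := by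
    simp only [q]; fun_prop
  have hGc : Continuous (fun p : ℝ × ℝ => G p.1 p.2) := by
    simp only [G]; fun_prop
  have hFc : Continuous (fun p : ℝ × ℝ => F p.1 p.2) := by
    simp only [F]; fun_prop
  have main := integral_balance_le (a := -1) (b := 1) (by norm_num) hcd
    (G := G) (G' := G') (F := F) (F' := F') (D := D) hGc
    (by simp only [G']; fun_prop) hFc (by simp only [F']; fun_prop)
    (by simp only [D]; fun_prop)
    (by
      intro x t ht
      have h1 := (((hasDerivAt_truncEnergy (2 * a) (e x t)).comp t (het x t ht.2)).const_mul
        3).add (((hasDerivAt_posEnergy (2 * a) (e x t)).comp t (het x t ht.2)).const_mul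
          ((1 - x) / a))
      refine ((hwd t).mul h1).congr_deriv ?_
      simp only [G', M, η, Pi.add_apply, Function.comp_apply]; ring)
    (by
      intro x t _
      have hphi : HasDerivAt (fun y : ℝ => (1 - y) / a) (-1 / a) x :=
        ((hasDerivAt_id x).const_sub 1).div_const a
      have h1 := (((hasDerivAt_truncEnergy (2 * a) (e x t)).comp x (hex x t)).const_mul
        3).add (hphi.mul ((hasDerivAt_posEnergy (2 * a) (e x t)).comp x (hex x t)))
      have h2 := (((hasDerivAt_truncFlux (2 * a) (e x t)).comp x (hex x t)).const_mul
        3).add (hphi.mul ((hasDerivAt_posFlux (2 * a) (e x t)).comp x (hex x t)))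
      have h3 : HasDerivAt (fun y : ℝ => -(y * s t)) (-s t) x :=
        (hasDerivAt_mul_const (s t)).neg
      refine (((h3.mul h1).add h2).const_mul (w t)).congr_deriv ?_
      simp only [F', M, η, Pi.add_apply, Pi.mul_apply, Function.comp_apply]; ring)
    (by
      intro x hx t ht
      have h := entropy_production_le (e := e x t) (R := R x t) ha1 (hs0 t) (hsa t) hx.1 hx.2
      have h1 := mul_le_mul_of_nonneg_left h (hw0 t)
      have h2 : G' x t + F' x t = w t * (-(1 + 2 * a) * η x (e x t)
          + M x (e x t) * (R x t + e x t * s t) - s t * η x (e x t)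
          + x * s t / a * posEnergy (2 * a) (e x t) - posFlux (2 * a) (e x t) / a) := by
        simp only [G', F', R]
        rw [heu x t]
        ring
      rw [h2]
      refine h1.trans ?_
      have h3 := mul_le_mul_of_nonneg_right (hwl t ht) (sq_nonneg (e x t))
      have h4 := mul_le_mul_of_nonneg_right (hw1 t ht) (sq_nonneg (R x t))
      simp only [D]
      linarith)
  have hGT : 0 ≤ ∫ x in (-1:ℝ)..1, G x δ := by
    refine intervalIntegral.integral_nonneg (by norm_num) fun x hx => ?_
    refine mul_nonneg (hw0 _) ?_
    have hB := posEnergy_nonneg hk (e x δ)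
    have hA := hB.trans (posEnergy_le_truncEnergy _ _)
    have : 0 ≤ (1 - x) / a := div_nonneg (by linarith [hx.2]) ha0.le
    positivity
  have phi_le : ∀ x ∈ Icc (-1:ℝ) 1, (1 - x) / a ≤ 2 := fun x hx => by
    rw [div_le_iff₀ ha0]; linarith [hx.1]
  have hG0 : (∫ x in (-1:ℝ)..1, G x (-1 + δ))
      ≤ 5 / 2 * ∫ x in (-1:ℝ)..1, e x (-1 + δ) ^ 2 := by
    rw [← intervalIntegral.integral_const_mul]
    refine intervalIntegral.integral_mono_on (by norm_num)
      ((continuous_slice_left hGc _).intervalIntegrable _ _)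
      ((((continuous_slice_left hec _).pow 2).const_mul _).intervalIntegrable _ _) fun x hx => ?_
    have hA := truncEnergy_le (2 * a) (e x (-1 + δ))
    have hB := posEnergy_nonneg hk (e x (-1 + δ))
    have hBA := posEnergy_le_truncEnergy (2 * a) (e x (-1 + δ))
    have := mul_le_mul_of_nonneg_right (phi_le x hx) hB
    simp only [G, η, hwi]
    linarith
  have hF1 : -(∫ t in (-1 + δ)..δ, F 1 t)
      ≤ (3 / 2 * a + N) * ∫ t in (-1 + δ)..δ, e 1 t ^ 2 := by
    rw [← intervalIntegral.integral_const_mul, ← intervalIntegral.integral_neg]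
    refine intervalIntegral.integral_mono_on hcd
      ((continuous_slice_right hFc _).neg.intervalIntegrable _ _)
      ((((continuous_slice_right hec _).pow 2).const_mul _).intervalIntegrable _ _) fun t ht => ?_
    have hA := truncEnergy_le (2 * a) (e 1 t)
    have hB := posEnergy_nonneg hk (e 1 t)
    have hA0 := hB.trans (posEnergy_le_truncEnergy (2 * a) (e 1 t))
    have hq := neg_truncFlux_le hk hN0 (e := e 1 t) (by
      have h1 := neg_abs_le (ustar 1 t)
      have h2 := hNub t ht
      have h3 := heu 1 t
      have h4 := hs0 t
      linarith)
    have h1 : s t * truncEnergy (2 * a) (e 1 t) ≤ a * (e 1 t ^ 2 / 2) :=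
      mul_le_mul (hsa t) hA hA0 ha0.le
    have h2 : -F 1 t = w t * (3 * (s t * truncEnergy (2 * a) (e 1 t))
        - 3 * truncFlux (2 * a) (e 1 t)) := by
      simp only [F, η, q]; ring
    have h3 : 3 * (s t * truncEnergy (2 * a) (e 1 t)) - 3 * truncFlux (2 * a) (e 1 t)
        ≤ (3 / 2 * a + N) * e 1 t ^ 2 := by linarith
    rw [h2]
    refine (mul_le_mul_of_nonneg_left h3 (hw0 t)).trans ?_
    exact mul_le_of_le_one_left (by positivity) (hw1 t ht)
  have hF2 : (∫ t in (-1 + δ)..δ, F (-1) t)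
      ≤ (15 / 2 * a) * ∫ t in (-1 + δ)..δ, e (-1) t ^ 2 := by
    rw [← intervalIntegral.integral_const_mul]
    refine intervalIntegral.integral_mono_on hcd
      ((continuous_slice_right hFc _).intervalIntegrable _ _)
      ((((continuous_slice_right hec _).pow 2).const_mul _).intervalIntegrable _ _) fun t ht => ?_
    have hA := truncEnergy_le (2 * a) (e (-1) t)
    have hB := posEnergy_nonneg hk (e (-1) t)
    have hBA := posEnergy_le_truncEnergy (2 * a) (e (-1) t)
    have hP := truncFlux_le hk (e (-1) t)
    have hQ := posFlux_le hk (e (-1) t)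
    have h1 : s t * truncEnergy (2 * a) (e (-1) t) ≤ a * (e (-1) t ^ 2 / 2) :=
      mul_le_mul (hsa t) hA (hB.trans hBA) ha0.le
    have h1' : s t * posEnergy (2 * a) (e (-1) t) ≤ a * (e (-1) t ^ 2 / 2) :=
      mul_le_mul (hsa t) (hBA.trans hA) hB ha0.le
    have h4 : 2 / a * (s t * posEnergy (2 * a) (e (-1) t) + posFlux (2 * a) (e (-1) t))
        ≤ 2 / a * (a * (3 / 2 * e (-1) t ^ 2)) :=
      mul_le_mul_of_nonneg_left (by linarith) (by positivity)
    have h5 : 2 / a * (a * (3 / 2 * e (-1) t ^ 2)) = 3 * e (-1) t ^ 2 := by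
      field_simp
    have h6 : 0 ≤ (a - 1) * e (-1) t ^ 2 := mul_nonneg (by linarith) (sq_nonneg _)
    have h2 : F (-1) t = w t * (3 * (s t * truncEnergy (2 * a) (e (-1) t))
        + 3 * truncFlux (2 * a) (e (-1) t)
        + 2 / a * (s t * posEnergy (2 * a) (e (-1) t) + posFlux (2 * a) (e (-1) t))) := by
      simp only [F, η, q]; ring
    have h3 : 3 * (s t * truncEnergy (2 * a) (e (-1) t))
        + 3 * truncFlux (2 * a) (e (-1) t)
        + 2 / a * (s t * posEnergy (2 * a) (e (-1) t) + posFlux (2 * a) (e (-1) t))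
        ≤ (15 / 2 * a) * e (-1) t ^ 2 := by linarith
    rw [h2]
    refine (mul_le_mul_of_nonneg_left h3 (hw0 t)).trans ?_
    exact mul_le_of_le_one_left (by positivity) (hw1 t ht)
  have he2c : Continuous (fun p : ℝ × ℝ => e p.1 p.2 ^ 2) := hec.pow 2
  have hR2c : Continuous (fun p : ℝ × ℝ => R p.1 p.2 ^ 2) := hRc.pow 2
  have hDint : (∫ t in (-1 + δ)..δ, ∫ x in (-1:ℝ)..1, D x t)
      = -(Real.exp (-(1 + 2 * a)) * ∫ t in (-1 + δ)..δ, ∫ x in (-1:ℝ)..1, e x t ^ 2)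
        + 5 / 2 * ∫ t in (-1 + δ)..δ, ∫ x in (-1:ℝ)..1, R x t ^ 2 := by
    rw [← integral_neg_mul_add_mul (continuous_integral_left (f := fun x t => e x t ^ 2) he2c)
      (continuous_integral_left (f := fun x t => R x t ^ 2) hR2c)]
    exact intervalIntegral.integral_congr fun t _ => integral_neg_mul_add_mul
      (continuous_slice_left (f := fun x t => e x t ^ 2) he2c t)
      (continuous_slice_left (f := fun x t => R x t ^ 2) hR2c t)
  rw [hDint] at main
  -- rewrite the residuals in terms of `e`
  have hE : (∫ t in (-1 + δ)..δ, ∫ x in (-1:ℝ)..1, (x / (t - 1) - ustar x t) ^ 2)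
      = ∫ t in (-1 + δ)..δ, ∫ x in (-1:ℝ)..1, e x t ^ 2 := by
    refine intervalIntegral.integral_congr fun t ht => ?_
    rw [uIcc_of_le hcd] at ht
    refine intervalIntegral.integral_congr fun x _ => ?_
    simp only [he, hut' x t ht.2]; ring
  have hI : (∫ x in (-1:ℝ)..1, (ustar x (-1 + δ) - x / (-2 + δ)) ^ 2)
      = ∫ x in (-1:ℝ)..1, e x (-1 + δ) ^ 2 := by
    refine intervalIntegral.integral_congr fun x _ => ?_
    have := hut' x (-1 + δ) hcd
    rw [show -1 + δ - 1 = -2 + δ by ring] at this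
    simp only [he, this]; ring
  have hS1 : (∫ t in (-1 + δ)..δ, (ustar (-1) t - 1 / (1 - t)) ^ 2)
      = ∫ t in (-1 + δ)..δ, e (-1) t ^ 2 := by
    refine intervalIntegral.integral_congr fun t ht => ?_
    rw [uIcc_of_le hcd] at ht
    simp only [he, hst t ht.2]; ring
  have hS2 : (∫ t in (-1 + δ)..δ, (ustar 1 t - 1 / (t - 1)) ^ 2)
      = ∫ t in (-1 + δ)..δ, e 1 t ^ 2 := by
    refine intervalIntegral.integral_congr fun t ht => ?_
    rw [uIcc_of_le hcd] at ht
    simp only [he, hut' 1 t ht.2]; ring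
  have hI0 : 0 ≤ ∫ x in (-1:ℝ)..1, e x (-1 + δ) ^ 2 :=
    intervalIntegral.integral_nonneg (by norm_num) fun _ _ => sq_nonneg _
  have hS10 : 0 ≤ ∫ t in (-1 + δ)..δ, e (-1) t ^ 2 :=
    intervalIntegral.integral_nonneg hcd fun _ _ => sq_nonneg _
  have hS20 : 0 ≤ ∫ t in (-1 + δ)..δ, e 1 t ^ 2 :=
    intervalIntegral.integral_nonneg hcd fun _ _ => sq_nonneg _
  have hJ0 : 0 ≤ ∫ t in (-1 + δ)..δ, ∫ x in (-1:ℝ)..1, R x t ^ 2 :=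
    intervalIntegral.integral_nonneg hcd fun _ _ =>
      intervalIntegral.integral_nonneg (by norm_num) fun _ _ => sq_nonneg _
  have hC : 1 + 2 / (1 - δ) = 1 + 2 * a := by rw [ha]; ring
  rw [hE, hI, hS1, hS2, hC, ← hN, ← ha]
  change _ ≤ _ * (_ + ∫ t in (-1 + δ)..δ, ∫ x in (-1:ℝ)..1, R x t ^ 2)
  have hr1 := Real.sqrt_nonneg (∫ t in (-1 + δ)..δ, e (-1) t ^ 2)
  have hr2 := Real.sqrt_nonneg (∫ t in (-1 + δ)..δ, e 1 t ^ 2)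
  have hlin : 0 ≤ 2 * (1 / (1 - δ) ^ 2) * (√(∫ t in (-1 + δ)..δ, e (-1) t ^ 2)
      + √(∫ t in (-1 + δ)..δ, e 1 t ^ 2)) := by positivity
  generalize 2 * (1 / (1 - δ) ^ 2) * (√(∫ t in (-1 + δ)..δ, e (-1) t ^ 2)
      + √(∫ t in (-1 + δ)..δ, e 1 t ^ 2)) = L at *
  generalize (∫ x in (-1:ℝ)..1, e x (-1 + δ) ^ 2) = I at *
  generalize (∫ t in (-1 + δ)..δ, e (-1) t ^ 2) = S₁ at *
  generalize (∫ t in (-1 + δ)..δ, e 1 t ^ 2) = S₂ at *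
  generalize (∫ t in (-1 + δ)..δ, ∫ x in (-1:ℝ)..1, R x t ^ 2) = J at *
  generalize (∫ t in (-1 + δ)..δ, ∫ x in (-1:ℝ)..1, e x t ^ 2) = E at *
  obtain ⟨X, hX⟩ : ∃ X, X = I + 2 * (N + 3 / 2 * a) * (S₁ + S₂) + L + J := ⟨_, rfl⟩
  rw [← hX]
  have hbound : Real.exp (-(1 + 2 * a)) * E ≤ 5 / 2 * X := by
    have h1 : 0 ≤ N * S₁ := by positivity
    have h2 : 0 ≤ N * S₂ := by positivity
    have h3 : 0 ≤ a * S₂ := by positivity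
    rw [hX]
    linarith
  have hX0 : 0 ≤ X := by rw [hX]; positivity
  have hEX : E ≤ 5 / 2 * Real.exp (1 + 2 * a) * X := by
    have h := mul_le_mul_of_nonneg_left hbound (Real.exp_pos (1 + 2 * a)).le
    rw [← mul_assoc, ← Real.exp_add, add_neg_cancel, Real.exp_zero, one_mul] at h
    linarith
  refine hEX.trans (mul_le_mul_of_nonneg_right ?_ hX0)
  have := mul_le_mul_of_nonneg_right (show 5 / 2 ≤ 1 + 2 * a by linarith)
    (Real.exp_pos (1 + 2 * a)).le
  linarith
end

section
/- Stability of the 1D PINN risk: in the setup of Theorem 2, if the surrogate residuals satisfy ∫∫R_int² ≤ ε, ∫R_tb² ≤ ε (and ∫|R_tb| ≤ ε), ∫R_{sb,-1}² ≤ ε, ∫R_{sb,1}² ≤ ε for some ε ∈ (0,1], then the L²-risk ∫∫|u - u*|² is bounded by K·√ε for a constant K depending only on δ and ‖u*(1,·)‖_∞; in particular the risk tends to 0 as all residual norms tend to 0. -/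
open MeasureTheory Set

lemma integrableOn_Ioc_prod {F : ℝ × ℝ → ℝ} (hF : Continuous F) (a b c d : ℝ) :
    IntegrableOn F (Ioc a b ×ˢ Ioc c d) :=
  (hF.continuousOn.integrableOn_compact (isCompact_Icc.prod isCompact_Icc)).mono_set
    (prod_mono Ioc_subset_Icc_self Ioc_subset_Icc_self)

lemma integral_Ioc_prod_eq_intervalIntegral {F : ℝ × ℝ → ℝ} (hF : Continuous F)
    {a b c d : ℝ} (hab : a ≤ b) (hcd : c ≤ d) :
    ∫ z in Ioc a b ×ˢ Ioc c d, F z = ∫ t in a..b, ∫ x in c..d, F (t, x) := by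
  simp only [intervalIntegral.integral_of_le hab, intervalIntegral.integral_of_le hcd]
  exact setIntegral_prod F (integrableOn_Ioc_prod hF a b c d)

lemma integral_Ioc_prod_eq_intervalIntegral_swap {F : ℝ × ℝ → ℝ} (hF : Continuous F)
    {a b c d : ℝ} (hab : a ≤ b) (hcd : c ≤ d) :
    ∫ z in Ioc a b ×ˢ Ioc c d, F z = ∫ x in c..d, ∫ t in a..b, F (t, x) := by
  have h := integral_Ioc_prod_eq_intervalIntegral (F := fun z => F z.swap)
    (hF.comp continuous_swap) hcd hab
  exact (setIntegral_prod_swap (μ := volume) (ν := volume) (Ioc a b) (Ioc c d) F).symm.trans h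

/-- Divergence theorem on a space-time rectangle. The first coordinate of the integration
variable is the time `t`. -/
lemma integral_divergence_Ioc_prod {P Pt Q Qx : ℝ → ℝ → ℝ} {a b c d : ℝ}
    (hab : a ≤ b) (hcd : c ≤ d)
    (hP : ∀ x, Continuous (P x))
    (hPt : Continuous fun z : ℝ × ℝ => Pt z.2 z.1)
    (hQx : Continuous fun z : ℝ × ℝ => Qx z.2 z.1)
    (hdP : ∀ x, ∀ t ∈ Ioo a b, HasDerivAt (P x) (Pt x t) t)
    (hdQ : ∀ x t, HasDerivAt (fun y => Q y t) (Qx x t) x) :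
    ∫ z in Ioc a b ×ˢ Ioc c d, (Pt z.2 z.1 + Qx z.2 z.1)
      = (∫ x in c..d, (P x b - P x a)) + ∫ t in a..b, (Q d t - Q c t) := by
  rw [integral_add (integrableOn_Ioc_prod hPt a b c d) (integrableOn_Ioc_prod hQx a b c d),
    integral_Ioc_prod_eq_intervalIntegral_swap hPt hab hcd,
    integral_Ioc_prod_eq_intervalIntegral hQx hab hcd]
  congr 1
  · refine intervalIntegral.integral_congr fun x _ => ?_
    exact intervalIntegral.integral_eq_sub_of_hasDerivAt_of_le hab (hP x).continuousOn
      (hdP x) ((hPt.comp (by fun_prop : Continuous fun t : ℝ => (t, x))).intervalIntegrable _ _)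
  · refine intervalIntegral.integral_congr fun t _ => ?_
    exact intervalIntegral.integral_eq_sub_of_hasDerivAt (fun x _ => hdQ x t)
      ((hQx.comp (by fun_prop : Continuous fun x : ℝ => (t, x))).intervalIntegrable _ _)

/-- Entropy flux of Burgers' equation for the smoothed absolute value `√(w² + κ²)`. -/
noncomputable def absEntropyFlux (κ w : ℝ) : ℝ := ∫ s in (0:ℝ)..w, s * (s / √(s ^ 2 + κ ^ 2))

lemma sqrt_sq_add_sq_pos {κ : ℝ} (hκ : 0 < κ) (w : ℝ) : 0 < √(w ^ 2 + κ ^ 2) :=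
  Real.sqrt_pos.2 (by positivity)

lemma continuous_div_sqrt_sq_add_sq {κ : ℝ} (hκ : 0 < κ) :
    Continuous fun w : ℝ => w / √(w ^ 2 + κ ^ 2) :=
  continuous_id.div (by fun_prop) fun w => (sqrt_sq_add_sq_pos hκ w).ne'

lemma hasDerivAt_absEntropyFlux {κ : ℝ} (hκ : 0 < κ) (w : ℝ) :
    HasDerivAt (absEntropyFlux κ) (w * (w / √(w ^ 2 + κ ^ 2))) w :=
  ((continuous_id.mul (continuous_div_sqrt_sq_add_sq hκ)).integral_hasStrictDerivAt
    0 w).hasDerivAt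

lemma continuous_absEntropyFlux {κ : ℝ} (hκ : 0 < κ) : Continuous (absEntropyFlux κ) :=
  continuous_iff_continuousAt.2 fun w => (hasDerivAt_absEntropyFlux hκ w).continuousAt

lemma hasDerivAt_sqrt_sq_add_sq {κ : ℝ} (hκ : 0 < κ) (w : ℝ) :
    HasDerivAt (fun w : ℝ => √(w ^ 2 + κ ^ 2)) (w / √(w ^ 2 + κ ^ 2)) w := by
  have h : HasDerivAt (fun w : ℝ => w ^ 2 + κ ^ 2) (2 * w) w := by
    simpa using (hasDerivAt_pow 2 w).add_const (κ ^ 2)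
  convert h.sqrt (by positivity) using 1
  field_simp

lemma abs_div_sqrt_sq_add_sq_le_one {κ : ℝ} (hκ : 0 < κ) (w : ℝ) :
    |w / √(w ^ 2 + κ ^ 2)| ≤ 1 := by
  rw [abs_div, abs_of_pos (sqrt_sq_add_sq_pos hκ w), div_le_one (sqrt_sq_add_sq_pos hκ w)]
  exact Real.abs_le_sqrt (by nlinarith)

lemma sqrt_sq_add_sq_le {κ : ℝ} (hκ : 0 < κ) (w : ℝ) : √(w ^ 2 + κ ^ 2) ≤ |w| + κ := by
  rw [Real.sqrt_le_left (by positivity)]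
  nlinarith [sq_abs w, abs_nonneg w]

lemma abs_absEntropyFlux_le {κ : ℝ} (hκ : 0 < κ) (w : ℝ) : |absEntropyFlux κ w| ≤ w ^ 2 := by
  have h : ‖∫ s in (0:ℝ)..w, s * (s / √(s ^ 2 + κ ^ 2))‖ ≤ |w| * |w - 0| := by
    refine intervalIntegral.norm_integral_le_of_norm_le_const fun s hs => ?_
    have h1 : |s| ≤ |w| := by
      have := abs_sub_left_of_mem_uIcc (uIoc_subset_uIcc hs)
      simpa using this
    rw [Real.norm_eq_abs, abs_mul]
    nlinarith [abs_div_sqrt_sq_add_sq_le_one hκ s, abs_nonneg s]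
  rw [sub_zero, abs_mul_abs_self] at h
  rw [sq]
  exact h

/-- Pointwise upper bound for the space-time divergence in the relative entropy identity. -/
lemma burgers_divergence_le {m κ x g U Ut Ux : ℝ} (hκ : 0 < κ) (hx : |x| ≤ 1)
    (hg : -m ≤ g) (hg' : g ≤ -(1 / 2)) :
    (m * ((U - x * g) / √((U - x * g) ^ 2 + κ ^ 2) * (Ut + x * g ^ 2))
        + (-(x * g ^ 2) * (U - x * g) + x * g * (Ut + x * g ^ 2)))
      + (m * ((U - x * g) * ((U - x * g) / √((U - x * g) ^ 2 + κ ^ 2)) * (Ux - g)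
            + (g * √((U - x * g) ^ 2 + κ ^ 2)
              + x * g * ((U - x * g) / √((U - x * g) ^ 2 + κ ^ 2) * (Ux - g))))
        + (g * (U - x * g) ^ 2 / 2 + x * g * ((U - x * g) * (Ux - g))
            + (2 * (x * g) * g * (U - x * g) + (x * g) ^ 2 * (Ux - g))))
      ≤ m / κ * (Ut + U * Ux) ^ 2 + m * κ - 1 / 4 * (x * g - U) ^ 2 := by
  have hr := abs_div_sqrt_sq_add_sq_le_one hκ (U - x * g)
  have hh := sqrt_sq_add_sq_pos hκ (U - x * g)
  have hwr : (U - x * g) * ((U - x * g) / √((U - x * g) ^ 2 + κ ^ 2))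
      ≤ √((U - x * g) ^ 2 + κ ^ 2) := by
    rw [← mul_div_assoc, div_le_iff₀ hh, Real.mul_self_sqrt (by positivity)]
    nlinarith
  set r := (U - x * g) / √((U - x * g) ^ 2 + κ ^ 2)
  set h := √((U - x * g) ^ 2 + κ ^ 2)
  have hm : 0 < m := by linarith
  have hxg : |x * g| ≤ m := by
    rw [abs_mul]
    have : |g| ≤ m := abs_le.2 ⟨hg, by linarith⟩
    nlinarith [abs_nonneg x, abs_nonneg g]
  have hcoef : |m * r + x * g| ≤ 2 * m := by
    refine (abs_add_le _ _).trans ?_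
    rw [abs_mul, abs_of_pos hm]
    nlinarith
  have hR : (m * r + x * g) * (Ut + U * Ux) ≤ 2 * m * |Ut + U * Ux| := by
    refine (le_abs_self _).trans ?_
    rw [abs_mul]
    exact mul_le_mul_of_nonneg_right hcoef (abs_nonneg _)
  have hy : 2 * m * |Ut + U * Ux| ≤ m / κ * (Ut + U * Ux) ^ 2 + m * κ := by
    have : m / κ * (Ut + U * Ux) ^ 2 + m * κ - 2 * m * |Ut + U * Ux|
        = m / κ * (|Ut + U * Ux| - κ) ^ 2 := by
      rw [← sq_abs (Ut + U * Ux)]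
      field_simp
      ring
    have : 0 ≤ m / κ * (|Ut + U * Ux| - κ) ^ 2 := by positivity
    linarith
  have hd : m * g * (h - (U - x * g) * r) ≤ 0 :=
    mul_nonpos_of_nonpos_of_nonneg (by nlinarith) (by linarith)
  have hq : g * (U - x * g) ^ 2 / 2 ≤ -(1 / 4) * (x * g - U) ^ 2 := by
    nlinarith [sq_nonneg (U - x * g)]
  linarith

lemma abs_burgers_flux_le {m κ u w : ℝ} (hm : 0 < m) (hκ : 0 < κ) (hu : |u| ≤ m) :
    |m * (absEntropyFlux κ w + u * √(w ^ 2 + κ ^ 2)) + (u * w ^ 2 / 2 + u ^ 2 * w)|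
      ≤ (3 / 2 * m + m ^ 2 / κ) * w ^ 2 + 2 * m ^ 2 * κ := by
  have hq := abs_absEntropyFlux_le hκ w
  have hh := sqrt_sq_add_sq_le hκ w
  have hu' := abs_nonneg u
  have hw := abs_nonneg w
  have hy : 2 * m ^ 2 * |w| ≤ m ^ 2 / κ * w ^ 2 + m ^ 2 * κ := by
    have : m ^ 2 / κ * w ^ 2 + m ^ 2 * κ - 2 * m ^ 2 * |w| = m ^ 2 / κ * (|w| - κ) ^ 2 := by
      rw [← sq_abs w]
      field_simp
      ring
    have : 0 ≤ m ^ 2 / κ * (|w| - κ) ^ 2 := by positivity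
    linarith
  have h1 : |u * √(w ^ 2 + κ ^ 2)| ≤ m * (|w| + κ) := by
    rw [abs_mul, abs_of_nonneg (Real.sqrt_nonneg _)]
    exact mul_le_mul hu hh (Real.sqrt_nonneg _) hm.le
  have h2 : |u * w ^ 2 / 2| ≤ m * w ^ 2 / 2 := by
    rw [abs_div, abs_mul, abs_of_nonneg (sq_nonneg w), abs_two]
    nlinarith [sq_nonneg w]
  have h3 : |u ^ 2 * w| ≤ m ^ 2 * |w| := by
    rw [abs_mul, abs_pow]
    gcongr
  calc _ ≤ m * (|absEntropyFlux κ w| + |u * √(w ^ 2 + κ ^ 2)|)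
        + (|u * w ^ 2 / 2| + |u ^ 2 * w|) := by
        refine (abs_add_le _ _).trans (add_le_add ?_ (abs_add_le _ _))
        rw [abs_mul, abs_of_pos hm]
        exact mul_le_mul_of_nonneg_left (abs_add_le _ _) hm.le
    _ ≤ m * (w ^ 2 + m * (|w| + κ)) + (m * w ^ 2 / 2 + m ^ 2 * |w|) := by gcongr
    _ ≤ _ := by linarith

lemma burgers_entropy_sub_ge {m κ u v w z : ℝ} (hm : 0 < m) (hκ : 0 < κ)
    (hu : |u| ≤ m) (hv : |v| ≤ m) :
    -(2 * m * |w| + m * κ)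
      ≤ (m * √(z ^ 2 + κ ^ 2) + v * z) - (m * √(w ^ 2 + κ ^ 2) + u * w) := by
  have h1 : |z| ≤ √(z ^ 2 + κ ^ 2) := Real.abs_le_sqrt (by nlinarith)
  have h2 := sqrt_sq_add_sq_le hκ w
  have h3 : |v * z| ≤ m * |z| := by rw [abs_mul]; gcongr
  have h4 : |u * w| ≤ m * |w| := by rw [abs_mul]; gcongr
  nlinarith [neg_abs_le (v * z), le_abs_self (u * w)]

/-- Quantitative `L²`-stability of the solution `x * g t` of Burgers' equation, where
`g' = -g²`, under perturbations with small residuals. -/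
lemma burgers_risk_le {a b m κ : ℝ} (hb : b = a + 1) (hκ : 0 < κ) (hκ1 : κ ≤ 1) {g : ℝ → ℝ} (hg : Continuous g)
    (hdg : ∀ t ∈ Ioo a b, HasDerivAt g (-(g t) ^ 2) t)
    (hgm : ∀ t ∈ Icc a b, -m ≤ g t) (hgn : ∀ t ∈ Icc a b, g t ≤ -(1 / 2))
    {U ut ux : ℝ → ℝ → ℝ}
    (hut : ∀ x t, HasDerivAt (fun s => U x s) (ut x t) t)
    (hux : ∀ x t, HasDerivAt (fun y => U y t) (ux x t) x)
    (hU : Continuous (fun p : ℝ × ℝ => U p.1 p.2))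
    (hcont_t : Continuous (fun p : ℝ × ℝ => ut p.1 p.2))
    (hcont_x : Continuous (fun p : ℝ × ℝ => ux p.1 p.2))
    (hint : ∫ t in a..b, ∫ x in (-1:ℝ)..1, (ut x t + U x t * ux x t) ^ 2 ≤ κ ^ 2)
    (htb : ∫ x in (-1:ℝ)..1, |U x a - x * g a| ≤ κ ^ 2)
    (hsbm : ∫ t in a..b, (U (-1) t - (-1) * g t) ^ 2 ≤ κ ^ 2)
    (hsbp : ∫ t in a..b, (U 1 t - 1 * g t) ^ 2 ≤ κ ^ 2) :
    ∫ t in a..b, ∫ x in (-1:ℝ)..1, (x * g t - U x t) ^ 2 ≤ (40 * m + 24 * m ^ 2) * κ := by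
  subst hb
  have hab : a ≤ a + 1 := by linarith
  have hm : 0 < m := by
    linarith [hgm a (left_mem_Icc.2 hab), hgn a (left_mem_Icc.2 hab)]
  have hxg : ∀ x ∈ Icc (-1:ℝ) 1, ∀ t ∈ Icc a (a + 1), |x * g t| ≤ m := by
    intro x hx t ht
    rw [abs_mul]
    have h1 : |g t| ≤ m := abs_le.2 ⟨hgm t ht, by linarith [hgn t ht]⟩
    nlinarith [abs_nonneg x, abs_nonneg (g t), abs_le.2 hx]
  have cU : Continuous fun z : ℝ × ℝ => U z.2 z.1 := hU.comp continuous_swap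
  have cut : Continuous fun z : ℝ × ℝ => ut z.2 z.1 := hcont_t.comp continuous_swap
  have cux : Continuous fun z : ℝ × ℝ => ux z.2 z.1 := hcont_x.comp continuous_swap
  have cUx : ∀ x, Continuous (U x) := fun x => hU.comp (by fun_prop : Continuous fun t => (x, t))
  have cUt : ∀ t, Continuous fun x => U x t :=
    fun t => hU.comp (by fun_prop : Continuous fun x => (x, t))
  have cr := continuous_div_sqrt_sq_add_sq hκ
  have cq := continuous_absEntropyFlux hκ
  have crw : Continuous fun z : ℝ × ℝ =>
      (U z.2 z.1 - z.2 * g z.1) / √((U z.2 z.1 - z.2 * g z.1) ^ 2 + κ ^ 2) :=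
    cr.comp (by fun_prop : Continuous fun z : ℝ × ℝ => U z.2 z.1 - z.2 * g z.1)
  have cQ : ∀ x, Continuous fun t => m * (absEntropyFlux κ (U x t - x * g t)
      + x * g t * √((U x t - x * g t) ^ 2 + κ ^ 2))
      + (x * g t * (U x t - x * g t) ^ 2 / 2 + (x * g t) ^ 2 * (U x t - x * g t)) := by
    intro x
    have := cUx x
    fun_prop
  have cP : ∀ t, Continuous fun x => m * √((U x t - x * g t) ^ 2 + κ ^ 2)
      + x * g t * (U x t - x * g t) := by
    intro t
    have := cUt t
    fun_prop
  have cPt : Continuous fun z : ℝ × ℝ =>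
      m * ((U z.2 z.1 - z.2 * g z.1) / √((U z.2 z.1 - z.2 * g z.1) ^ 2 + κ ^ 2)
          * (ut z.2 z.1 + z.2 * g z.1 ^ 2))
        + (-(z.2 * g z.1 ^ 2) * (U z.2 z.1 - z.2 * g z.1)
          + z.2 * g z.1 * (ut z.2 z.1 + z.2 * g z.1 ^ 2)) := by
    fun_prop
  have cQx : Continuous fun z : ℝ × ℝ =>
      m * ((U z.2 z.1 - z.2 * g z.1)
            * ((U z.2 z.1 - z.2 * g z.1) / √((U z.2 z.1 - z.2 * g z.1) ^ 2 + κ ^ 2))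
            * (ux z.2 z.1 - g z.1)
          + (g z.1 * √((U z.2 z.1 - z.2 * g z.1) ^ 2 + κ ^ 2)
            + z.2 * g z.1
              * ((U z.2 z.1 - z.2 * g z.1) / √((U z.2 z.1 - z.2 * g z.1) ^ 2 + κ ^ 2)
                * (ux z.2 z.1 - g z.1))))
        + (g z.1 * (U z.2 z.1 - z.2 * g z.1) ^ 2 / 2
            + z.2 * g z.1 * ((U z.2 z.1 - z.2 * g z.1) * (ux z.2 z.1 - g z.1))
            + (2 * (z.2 * g z.1) * g z.1 * (U z.2 z.1 - z.2 * g z.1)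
              + (z.2 * g z.1) ^ 2 * (ux z.2 z.1 - g z.1))) := by
    fun_prop
  have hdiv := integral_divergence_Ioc_prod (a := a) (b := a + 1) (c := -1) (d := 1)
    (P := fun x t => m * √((U x t - x * g t) ^ 2 + κ ^ 2) + x * g t * (U x t - x * g t))
    (Pt := fun x t =>
      m * ((U x t - x * g t) / √((U x t - x * g t) ^ 2 + κ ^ 2) * (ut x t + x * g t ^ 2))
        + (-(x * g t ^ 2) * (U x t - x * g t) + x * g t * (ut x t + x * g t ^ 2)))
    (Q := fun x t => m * (absEntropyFlux κ (U x t - x * g t)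
      + x * g t * √((U x t - x * g t) ^ 2 + κ ^ 2))
      + (x * g t * (U x t - x * g t) ^ 2 / 2 + (x * g t) ^ 2 * (U x t - x * g t)))
    (Qx := fun x t =>
      m * ((U x t - x * g t) * ((U x t - x * g t) / √((U x t - x * g t) ^ 2 + κ ^ 2))
            * (ux x t - g t)
          + (g t * √((U x t - x * g t) ^ 2 + κ ^ 2)
            + x * g t * ((U x t - x * g t) / √((U x t - x * g t) ^ 2 + κ ^ 2) * (ux x t - g t))))
        + (g t * (U x t - x * g t) ^ 2 / 2 + x * g t * ((U x t - x * g t) * (ux x t - g t))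
            + (2 * (x * g t) * g t * (U x t - x * g t) + (x * g t) ^ 2 * (ux x t - g t))))
    hab (by norm_num)
    (by
      intro x
      have := cUx x
      fun_prop)
    cPt cQx
    (by
      intro x t ht
      have hxg' : HasDerivAt (fun s => x * g s) (-(x * g t ^ 2)) t := by
        simpa using (hdg t ht).const_mul x
      have hw : HasDerivAt (fun s => U x s - x * g s) (ut x t + x * g t ^ 2) t :=
        ((hut x t).sub hxg').congr_deriv (by ring)
      exact (((hasDerivAt_sqrt_sq_add_sq hκ _).comp t hw).const_mul m).add (hxg'.mul hw))
    (by
      intro x t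
      have hxg' : HasDerivAt (fun y => y * g t) (g t) x := by
        simpa using (hasDerivAt_id x).mul_const (g t)
      have hw : HasDerivAt (fun y => U y t - y * g t) (ux x t - g t) x := (hux x t).sub hxg'
      have hh := (hasDerivAt_sqrt_sq_add_sq hκ (U x t - x * g t)).comp x hw
      have hq := (hasDerivAt_absEntropyFlux hκ (U x t - x * g t)).comp x hw
      exact (((hq.add (hxg'.mul hh)).const_mul m).add
        (((hxg'.mul (hw.pow 2)).div_const 2).add ((hxg'.pow 2).mul hw))).congr_deriv (by
          simp only [Function.comp_apply, Pi.pow_apply, Nat.cast_ofNat, Nat.add_one_sub_one,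
            pow_one]
          ring))
  have hR : Continuous fun z : ℝ × ℝ => (ut z.2 z.1 + U z.2 z.1 * ux z.2 z.1) ^ 2 := by fun_prop
  have hW : Continuous fun z : ℝ × ℝ => (z.2 * g z.1 - U z.2 z.1) ^ 2 := by fun_prop
  have hRm : Continuous fun z : ℝ × ℝ =>
      m / κ * (ut z.2 z.1 + U z.2 z.1 * ux z.2 z.1) ^ 2 + m * κ := by fun_prop
  have hupper := setIntegral_mono_on
    (integrableOn_Ioc_prod (cPt.add cQx) a (a + 1) (-1) 1)
    (integrableOn_Ioc_prod (hRm.sub (hW.const_mul (1 / 4))) a (a + 1) (-1) 1)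
    (measurableSet_Ioc.prod measurableSet_Ioc)
    (fun z hz => burgers_divergence_le (m := m) (Ut := ut z.2 z.1) (Ux := ux z.2 z.1) hκ
      (abs_le.2 (Ioc_subset_Icc_self hz.2))
      (hgm z.1 (Ioc_subset_Icc_self hz.1)) (hgn z.1 (Ioc_subset_Icc_self hz.1)))
  have hlower : -(2 * m * κ ^ 2 + 2 * m * κ) ≤ ∫ x in (-1:ℝ)..1,
      ((m * √((U x (a + 1) - x * g (a + 1)) ^ 2 + κ ^ 2)
          + x * g (a + 1) * (U x (a + 1) - x * g (a + 1)))
        - (m * √((U x a - x * g a) ^ 2 + κ ^ 2) + x * g a * (U x a - x * g a))) := by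
    have c0 : Continuous fun x => |U x a - x * g a| := by
      have := cUt a
      fun_prop
    have h := intervalIntegral.integral_mono_on (μ := volume) (a := -1) (b := 1) (by norm_num)
      (((c0.const_mul (2 * m)).add (continuous_const (y := m * κ))).neg.intervalIntegrable _ _)
      (((cP (a + 1)).sub (cP a)).intervalIntegrable _ _)
      (fun x hx => burgers_entropy_sub_ge hm hκ
        (hxg x hx a (left_mem_Icc.2 hab)) (hxg x hx (a + 1) (right_mem_Icc.2 hab)))
    refine le_trans ?_ h
    simp only [Pi.add_apply, Pi.neg_apply]
    rw [intervalIntegral.integral_neg, intervalIntegral.integral_add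
      ((c0.const_mul (2 * m)).intervalIntegrable _ _) (continuous_const.intervalIntegrable _ _),
      intervalIntegral.integral_const_mul, intervalIntegral.integral_const, smul_eq_mul]
    nlinarith
  have hflux : ∀ x ∈ Icc (-1:ℝ) 1, ∫ t in a..(a + 1), (U x t - x * g t) ^ 2 ≤ κ ^ 2 →
      |∫ t in a..(a + 1), (m * (absEntropyFlux κ (U x t - x * g t)
        + x * g t * √((U x t - x * g t) ^ 2 + κ ^ 2))
        + (x * g t * (U x t - x * g t) ^ 2 / 2 + (x * g t) ^ 2 * (U x t - x * g t)))|
      ≤ (3 / 2 * m + m ^ 2 / κ) * κ ^ 2 + 2 * m ^ 2 * κ := by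
    intro x hx hle
    have c0 : Continuous fun t => (U x t - x * g t) ^ 2 := by
      have := cUx x
      fun_prop
    have h := intervalIntegral.integral_mono_on (μ := volume) hab
      ((cQ x).abs.intervalIntegrable _ _)
      (((c0.const_mul (3 / 2 * m + m ^ 2 / κ)).add
        (continuous_const (y := 2 * m ^ 2 * κ))).intervalIntegrable _ _)
      (fun t ht => abs_burgers_flux_le hm hκ (hxg x hx t ht))
    refine (intervalIntegral.abs_integral_le_integral_abs hab).trans (h.trans ?_)
    simp only [Pi.add_apply]
    rw [intervalIntegral.integral_add
      ((c0.const_mul _).intervalIntegrable _ _) (continuous_const.intervalIntegrable _ _),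
      intervalIntegral.integral_const_mul, intervalIntegral.integral_const, smul_eq_mul,
      add_sub_cancel_left, one_mul]
    gcongr
  have hQp := abs_le.1 (hflux 1 (by simp) hsbp)
  have hQm := abs_le.1 (hflux (-1) (by simp) hsbm)
  have hvol : ∫ _ in Ioc a (a + 1) ×ˢ Ioc (-1:ℝ) 1, m * κ = 2 * (m * κ) := by
    rw [integral_Ioc_prod_eq_intervalIntegral (F := fun _ => m * κ) continuous_const hab
      (by norm_num)]
    simp
    ring
  simp only [Pi.add_apply, Pi.sub_apply] at hupper
  rw [hdiv, intervalIntegral.integral_sub ((cQ 1).intervalIntegrable _ _)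
    ((cQ (-1)).intervalIntegrable _ _), integral_sub
    (integrableOn_Ioc_prod hRm a (a + 1) (-1) 1)
    (integrableOn_Ioc_prod (hW.const_mul (1 / 4)) a (a + 1) (-1) 1), integral_add
    (integrableOn_Ioc_prod (hR.const_mul (m / κ)) a (a + 1) (-1) 1)
    (integrableOn_Ioc_prod continuous_const a (a + 1) (-1) 1),
    hvol, integral_const_mul, integral_const_mul,
    integral_Ioc_prod_eq_intervalIntegral hR hab (by norm_num),
    integral_Ioc_prod_eq_intervalIntegral hW hab (by norm_num)] at hupper
  have hRb := mul_le_mul_of_nonneg_left hint (by positivity : 0 ≤ m / κ)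
  have e1 : m / κ * κ ^ 2 = m * κ := by field_simp
  have e2 : m ^ 2 / κ * κ ^ 2 = m ^ 2 * κ := by field_simp
  have e3 : m * κ ^ 2 ≤ m * κ := by nlinarith [mul_pos hm hκ]
  rw [add_mul, e2] at hQp hQm
  rw [e1] at hRb
  linarith [hQp.1, hQm.2]


/-- Stability of the 1D PINN risk: in the setup of Theorem 2, if all residual
norms are at most ε ∈ (0,1], then the L²-risk is bounded by K √ε with
K = (1 + C e^C)(1 + 2C_{2b} + 4C_{1b} + 1); in particular the risk tends to 0
as the residuals tend to 0. -/
theorem stmt18 (δ : ℝ) (hδ : δ ∈ Set.Ioo (0:ℝ) 1)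
    (ustar ut ux : ℝ → ℝ → ℝ)
    (hut : ∀ x t, HasDerivAt (fun s => ustar x s) (ut x t) t)
    (hux : ∀ x t, HasDerivAt (fun y => ustar y t) (ux x t) x)
    (hcont : Continuous (fun p : ℝ × ℝ => ustar p.1 p.2))
    (hcont_t : Continuous (fun p : ℝ × ℝ => ut p.1 p.2))
    (hcont_x : Continuous (fun p : ℝ × ℝ => ux p.1 p.2))
    (ε : ℝ) (hε : ε ∈ Set.Ioc (0:ℝ) 1)
    (hint : ∫ t in (-1+δ)..δ, ∫ x in (-1:ℝ)..1,
        (ut x t + ustar x t * ux x t)^2 ≤ ε)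
    (htb2 : ∫ x in (-1:ℝ)..1, (ustar x (-1+δ) - x/(-2+δ))^2 ≤ ε)
    (htb1 : ∫ x in (-1:ℝ)..1, |ustar x (-1+δ) - x/(-2+δ)| ≤ ε)
    (hsbm : ∫ t in (-1+δ)..δ, (ustar (-1) t - 1/(1-t))^2 ≤ ε)
    (hsbp : ∫ t in (-1+δ)..δ, (ustar 1 t - 1/(t-1))^2 ≤ ε) :
    (∫ t in (-1+δ)..δ, ∫ x in (-1:ℝ)..1, (x/(t-1) - ustar x t)^2)
      ≤ ((1 + (1 + 2/(1-δ)) * Real.exp (1 + 2/(1-δ)))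
          * (1 + 2 * (sSup ((fun t => |ustar 1 t|) '' Set.Icc (-1+δ) δ)
                + (3/2) * (1/(1-δ)))
             + 4 * (1/(1-δ)^2) + 1)) * Real.sqrt ε := by
  obtain ⟨hδ0, hδ1⟩ := hδ
  obtain ⟨hε0, hε1⟩ := hε
  have hab : -1 + δ ≤ δ := by linarith
  have hκ : 0 < √ε := Real.sqrt_pos.2 hε0
  have hκ1 : √ε ≤ 1 := Real.sqrt_le_one.2 hε1
  have hsq : √ε ^ 2 = ε := Real.sq_sqrt hε0.le
  have hg : Continuous fun t : ℝ => 1 / (min t δ - 1) :=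
    continuous_const.div (by fun_prop) fun t => by linarith [min_le_right t δ]
  have hgt : ∀ t, t ≤ δ → 1 / (min t δ - 1) = 1 / (t - 1) := fun t ht => by rw [min_eq_left ht]
  have hneg : ∀ t : ℝ, 1 / (t - 1) = -(1 / (1 - t)) := fun t => by
    rw [← neg_sub 1 t, div_neg]
  have hdg : ∀ t ∈ Ioo (-1 + δ) δ, HasDerivAt (fun t : ℝ => 1 / (min t δ - 1))
      (-(1 / (min t δ - 1)) ^ 2) t := by
    intro t ht
    have hne : t - 1 ≠ 0 := by linarith [ht.2]
    have h : HasDerivAt (fun t : ℝ => 1 / (t - 1)) (-(1 / (t - 1)) ^ 2) t := by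
      simpa [div_eq_mul_inv] using ((hasDerivAt_id t).sub_const 1).fun_inv hne
    rw [hgt t ht.2.le]
    exact h.congr_of_eventuallyEq ((eventually_le_nhds ht.2).mono hgt)
  have key := burgers_risk_le (a := -1 + δ) (b := δ) (m := 1 / (1 - δ)) (by ring) hκ hκ1 hg hdg
    (fun t ht => by
      rw [hgt t ht.2, hneg, neg_le_neg_iff]
      exact one_div_le_one_div_of_le (by linarith) (by linarith [ht.2]))
    (fun t ht => by
      rw [hgt t ht.2, hneg, neg_le_neg_iff]
      exact one_div_le_one_div_of_le (by linarith [ht.2]) (by linarith [ht.1]))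
    hut hux hcont hcont_t hcont_x (by rwa [hsq])
    (by
      rw [hsq, hgt _ hab]
      convert htb1 using 5
      ring)
    (by
      rw [hsq]
      refine le_trans (le_of_eq (intervalIntegral.integral_congr fun t ht => ?_)) hsbm
      rw [uIcc_of_le hab] at ht
      simp only [hgt t ht.2, hneg t]
      ring)
    (by
      rw [hsq]
      refine le_trans (le_of_eq (intervalIntegral.integral_congr fun t ht => ?_)) hsbp
      rw [uIcc_of_le hab] at ht
      simp only [hgt t ht.2, one_mul])
  have hrisk : (∫ t in (-1+δ)..δ, ∫ x in (-1:ℝ)..1, (x/(t-1) - ustar x t)^2)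
      = ∫ t in (-1+δ)..δ, ∫ x in (-1:ℝ)..1, (x * (1 / (min t δ - 1)) - ustar x t) ^ 2 := by
    refine intervalIntegral.integral_congr fun t ht => ?_
    rw [uIcc_of_le hab] at ht
    simp only [hgt t ht.2, mul_one_div]
  rw [hrisk]
  refine key.trans (mul_le_mul_of_nonneg_right ?_ hκ.le)
  have hS : 0 ≤ sSup ((fun t => |ustar 1 t|) '' Set.Icc (-1+δ) δ) :=
    Real.sSup_nonneg (by rintro _ ⟨t, _, rfl⟩; exact abs_nonneg _)
  have hm : 1 ≤ 1 / (1 - δ) := by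
    rw [le_div_iff₀ (by linarith)]
    linarith
  have e1 : 2 / (1 - δ) = 2 * (1 / (1 - δ)) := by ring
  have e2 : 1 / (1 - δ) ^ 2 = (1 / (1 - δ)) ^ 2 := by rw [one_div_pow]
  rw [e1, e2]
  generalize 1 / (1 - δ) = m at hm
  generalize sSup ((fun t => |ustar 1 t|) '' Set.Icc (-1+δ) δ) = S at hS
  have hexp : 4 ≤ Real.exp (1 + 2 * m) := by linarith [Real.add_one_le_exp (1 + 2 * m)]
  have h13 : 13 ≤ 1 + (1 + 2 * m) * Real.exp (1 + 2 * m) := by nlinarith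
  calc 40 * m + 24 * m ^ 2 ≤ 13 * (1 + 2 * (S + 3 / 2 * m) + 4 * m ^ 2 + 1) := by nlinarith
    _ ≤ _ := mul_le_mul_of_nonneg_right h13 (by positivity)
end
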